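/- Let μ ∈ ℂ with μ ≠ 0. Over the field ℂ(x) of rational functions, let A₁ be the 2×2 matrix [[−2−2μ/x, 4/x], [−μ−μ²/x, 2+2μ/x]] (the matrix of the first variational equation of the Painlevé III equation with parameters (2μ−1, −2μ+1, 1, −1) along its solution y = 1), and let Q₁ be the constant matrix [[−2μ, 1], [−μ², 0]]. Then Q₁ is invertible (det Q₁ = μ²), and Q₁⁻¹·A₁·Q₁ = [[0, 1/μ + 1/x], [4μ, 0]]; in particular this conjugate has trace 0 and decomposes as (1/x)·[[0,1],[0,0]] + [[0, 1/μ], [4μ, 0]]. -/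

import Mathlib

set_option synthInstance.maxHeartbeats 1000000
set_option maxHeartbeats 1000000

/-- The matrix of the first variational equation of Painlevé III (parameters
`(2μ−1, −2μ+1, 1, −1)`) along the solution `y = 1`. -/
noncomputable def A₁ (μ : ℂ) : Matrix (Fin 2) (Fin 2) (RatFunc ℂ) :=
  !![-2 - 2 * RatFunc.C μ / RatFunc.X, 4 / RatFunc.X;
     -RatFunc.C μ - RatFunc.C μ ^ 2 / RatFunc.X, 2 + 2 * RatFunc.C μ / RatFunc.X]

noncomputable def Q₁ (μ : ℂ) : Matrix (Fin 2) (Fin 2) (RatFunc ℂ) :=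
  !![-2 * RatFunc.C μ, 1; -RatFunc.C μ ^ 2, 0]

theorem det_Q₁ (μ : ℂ) : (Q₁ μ).det = RatFunc.C μ ^ 2 := by
  simp [Q₁, Matrix.det_fin_two_of]

/-- The intertwining relation between `A₁` and its conjugate by `Q₁`. -/
theorem A₁_mul_Q₁ {μ : ℂ} (hμ : μ ≠ 0) :
    A₁ μ * Q₁ μ =
      Q₁ μ * !![0, (RatFunc.C μ)⁻¹ + (RatFunc.X : RatFunc ℂ)⁻¹; 4 * RatFunc.C μ, 0] := by
  have hC : RatFunc.C μ ≠ 0 := (map_ne_zero RatFunc.C).2 hμ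
  have hX : (RatFunc.X : RatFunc ℂ) ≠ 0 := RatFunc.X_ne_zero
  rw [A₁, Q₁, Matrix.mul_fin_two, Matrix.mul_fin_two]
  generalize RatFunc.C μ = c at hC ⊢
  generalize (RatFunc.X : RatFunc ℂ) = x at hX ⊢
  ext i j
  fin_cases i <;> fin_cases j <;> simp <;> field_simp <;> ring

/-- `Q₁` is invertible with `det Q₁ = μ²`, and conjugating `A₁` by `Q₁` gives
`[[0, 1/μ + 1/x], [4μ, 0]]`, which is trace-free and decomposes as
`(1/x)·[[0,1],[0,0]] + [[0,1/μ],[4μ,0]]`. -/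
theorem stmt_11 (μ : ℂ) (hμ : μ ≠ 0) :
    (Q₁ μ).det = RatFunc.C μ ^ 2 ∧ IsUnit (Q₁ μ) ∧
    (Q₁ μ)⁻¹ * A₁ μ * Q₁ μ =
      !![0, (RatFunc.C μ)⁻¹ + (RatFunc.X : RatFunc ℂ)⁻¹; 4 * RatFunc.C μ, 0] ∧
    Matrix.trace ((Q₁ μ)⁻¹ * A₁ μ * Q₁ μ) = 0 ∧
    (Q₁ μ)⁻¹ * A₁ μ * Q₁ μ =
      (RatFunc.X : RatFunc ℂ)⁻¹ • (!![0, 1; 0, 0] : Matrix (Fin 2) (Fin 2) (RatFunc ℂ))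
        + !![0, (RatFunc.C μ)⁻¹; 4 * RatFunc.C μ, 0] := by
  have hdet : IsUnit (Q₁ μ).det := by
    rw [det_Q₁]
    exact (pow_ne_zero 2 ((map_ne_zero RatFunc.C).2 hμ)).isUnit
  have hconj : (Q₁ μ)⁻¹ * A₁ μ * Q₁ μ =
      !![0, (RatFunc.C μ)⁻¹ + (RatFunc.X : RatFunc ℂ)⁻¹; 4 * RatFunc.C μ, 0] := by
    rw [Matrix.mul_assoc, A₁_mul_Q₁ hμ, Matrix.nonsing_inv_mul_cancel_left _ _ hdet]
  refine ⟨det_Q₁ μ, (Matrix.isUnit_iff_isUnit_det _).2 hdet, hconj, ?_, ?_⟩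
  · rw [hconj, Matrix.trace_fin_two_of, add_zero]
  · rw [hconj]
    ext i j
    fin_cases i <;> fin_cases j <;> simp [add_comm]
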